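/- Fix θ > 0 and positive integers p and ℓ. Let σ_N be an Ewens(θ)-distributed random permutation of S_N and let Γ^{(N)}_p be its number of cycles of length p. Then the ℓ-th cumulant of Γ^{(N)}_p satisfies κ_ℓ(Γ^{(N)}_p) = θ/p + O(N^{−1}) as N → ∞; i.e., there is a constant C (depending on p, ℓ, θ) with |κ_ℓ(Γ^{(N)}_p) − θ/p| ≤ C/N for all N. -/

import Mathlib

open scoped BigOperators Classical
open Finset

noncomputable section

/-- Total number of cycles of a permutation of `Fin N`, fixed points included. -/
def cycleCount {N : ℕ} (σ : Equiv.Perm (Fin N)) : ℕ :=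
  Multiset.card σ.cycleType + (N - σ.cycleType.sum)

/-- Expectation of `f` under the Ewens measure with parameter `θ` on `S_N`. -/
def ewensE (θ : ℝ) (N : ℕ) (f : Equiv.Perm (Fin N) → ℝ) : ℝ :=
  (∑ σ : Equiv.Perm (Fin N), θ ^ cycleCount σ * f σ) / ∏ k ∈ Finset.range N, (θ + (k : ℝ))

/-- Probability of an event under the Ewens measure. -/
def ewensP (θ : ℝ) (N : ℕ) (A : Set (Equiv.Perm (Fin N))) : ℝ :=
  ewensE θ N (fun σ => if σ ∈ A then 1 else 0)

/-- The Bernoulli random variable `B^{(N)}_{i,s}`, equal to 1 iff `σ i = s`. -/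
def Bis {N : ℕ} (i s : Fin N) (σ : Equiv.Perm (Fin N)) : ℝ :=
  if σ i = s then 1 else 0

/-- The set partitions of a finset `S`, encoded as finsets of nonempty disjoint finsets
covering `S`. -/
def partitionsOf {ι : Type*} [DecidableEq ι] (S : Finset ι) : Finset (Finset (Finset ι)) :=
  S.powerset.powerset.filter
    (fun P => (∀ C ∈ P, C.Nonempty) ∧ ∀ j ∈ S, ∃! C, C ∈ P ∧ j ∈ C)

/-- The joint cumulant of the family of random variables indexed by `S`, expressed through
the moments function `M` : `κ = Σ_π (−1)^{#π−1} (#π−1)! Π_{C ∈ π} M C`. -/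
def cumulantOn {ι 𝕜 : Type*} [DecidableEq ι] [Field 𝕜] (S : Finset ι) (M : Finset ι → 𝕜) : 𝕜 :=
  ∑ P ∈ partitionsOf S,
    (-1 : 𝕜) ^ (P.card - 1) * ((P.card - 1).factorial : 𝕜) * ∏ C ∈ P, M C


/-- Number of cycles of length `p` of a permutation of `Fin N` (fixed points are the cycles
of length 1). -/
def cyclesOfLength {N : ℕ} (p : ℕ) (σ : Equiv.Perm (Fin N)) : ℕ :=
  if p = 1 then N - σ.cycleType.sum else Multiset.count p σ.cycleType

/-- The order of the centralizer of a permutation whose cycle lengths, fixed points included,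
form the multiset `m`. -/
def centralizerSize (m : Multiset ℕ) : ℕ :=
  m.prod * ∏ n ∈ m.toFinset, (m.count n).factorial

theorem prod_factorial_count_subset (m : Multiset ℕ) {s : Finset ℕ} (h : m.toFinset ⊆ s) :
    ∏ n ∈ m.toFinset, (m.count n).factorial = ∏ n ∈ s, (m.count n).factorial := by
  refine Finset.prod_subset h fun n _ hn => ?_
  rw [Multiset.mem_toFinset] at hn
  simp [Multiset.count_eq_zero_of_notMem hn]

theorem centralizerSize_cons (p : ℕ) (m : Multiset ℕ) :
    centralizerSize (p ::ₘ m) = p * (m.count p + 1) * centralizerSize m := by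
  unfold centralizerSize
  rw [prod_factorial_count_subset m (s := (p ::ₘ m).toFinset)
    (Multiset.toFinset_subset.2 (Multiset.subset_cons m p)),
    ← Finset.mul_prod_erase _ _ (show p ∈ (p ::ₘ m).toFinset by simp),
    ← Finset.mul_prod_erase (a := p) _ (fun n => (m.count n).factorial)
      (show p ∈ (p ::ₘ m).toFinset by simp)]
  have : ∀ n ∈ (p ::ₘ m).toFinset.erase p,
      ((p ::ₘ m).count n).factorial = (m.count n).factorial := fun n hn => by
    rw [Multiset.count_cons_of_ne (Finset.ne_of_mem_erase hn)]
  rw [Finset.prod_congr rfl this, Multiset.count_cons_self, Nat.factorial_succ, Multiset.prod_cons]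
  ring

theorem centralizerSize_pos {m : Multiset ℕ} (h : ∀ i ∈ m, 0 < i) : 0 < centralizerSize m :=
  Nat.mul_pos (Multiset.prod_pos h) (Finset.prod_pos fun _ _ => Nat.factorial_pos _)

theorem centralizerSize_add_replicate_one {m : Multiset ℕ} (h : 1 ∉ m) (c : ℕ) :
    centralizerSize (m + Multiset.replicate c 1) = c.factorial * centralizerSize m := by
  induction c with
  | zero => simp
  | succ c ih =>
    rw [Multiset.replicate_succ, Multiset.add_cons, centralizerSize_cons, ih,
      Multiset.count_add, Multiset.count_eq_zero_of_notMem h, Multiset.count_replicate_self,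
      Nat.factorial_succ]
    ring

theorem Nat.Partition.parts_eq_filter_add_replicate {n : ℕ} (l : n.Partition) :
    l.parts = l.parts.filter (2 ≤ ·) +
      Multiset.replicate (n - (l.parts.filter (2 ≤ ·)).sum) 1 := by
  have h : l.parts.filter (fun i => ¬ 2 ≤ i) =
      Multiset.replicate (Multiset.card (l.parts.filter (fun i => ¬ 2 ≤ i))) 1 := by
    refine Multiset.eq_replicate.2 ⟨rfl, fun i hi => ?_⟩
    rw [Multiset.mem_filter] at hi
    have := l.parts_pos hi.1
    omega
  have hadd := Multiset.filter_add_not (2 ≤ ·) l.parts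
  have hsum := congrArg Multiset.sum hadd
  rw [Multiset.sum_add, l.parts_sum, h, Multiset.sum_replicate, smul_eq_mul, mul_one] at hsum
  conv_lhs => rw [← hadd, h]
  congr 2
  omega

theorem card_perm_partition_eq {α : Type*} [Fintype α] [DecidableEq α]
    (l : (Fintype.card α).Partition) :
    #{σ : Equiv.Perm α | σ.partition = l} * centralizerSize l.parts
      = (Fintype.card α).factorial := by
  set m := l.parts.filter (2 ≤ ·) with hm
  have hl := l.parts_eq_filter_add_replicate
  rw [← hm] at hl
  have hm2 : ∀ a ∈ m, 2 ≤ a := fun a ha => (Multiset.mem_filter.1 ha).2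
  have hsum : m.sum ≤ Fintype.card α := by
    have := congrArg Multiset.sum hl
    rw [Multiset.sum_add, l.parts_sum] at this
    omega
  have hset : ({σ : Equiv.Perm α | σ.partition = l} : Finset (Equiv.Perm α))
      = ({σ : Equiv.Perm α | σ.cycleType = m} : Finset (Equiv.Perm α)) := by
    ext σ
    simp only [Finset.mem_filter, Finset.mem_univ, true_and]
    constructor
    · rintro rfl
      exact Equiv.Perm.filter_parts_partition_eq_cycleType.symm
    · intro h
      ext1
      rw [Equiv.Perm.parts_partition, ← Equiv.Perm.sum_cycleType, h, ← hl]
  have key := Equiv.Perm.card_of_cycleType_mul_eq (α := α) m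
  rw [if_pos ⟨hsum, hm2⟩] at key
  rw [hset, ← key, hl, centralizerSize_add_replicate_one fun h => by simpa using hm2 1 h,
    centralizerSize]
  simp only [mul_assoc]

/-- The weight `θ ^ ℓ(m) / z_m` of a multiset `m` of cycle lengths under the unnormalised Ewens
measure. -/
def partitionWeight (θ : ℝ) (m : Multiset ℕ) : ℝ :=
  θ ^ Multiset.card m / centralizerSize m

theorem partitionWeight_cons (θ : ℝ) {p : ℕ} (hp : 0 < p) (m : Multiset ℕ) :
    (p ::ₘ m).count p * partitionWeight θ (p ::ₘ m) = θ / p * partitionWeight θ m := by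
  rw [partitionWeight, partitionWeight, centralizerSize_cons, Multiset.count_cons_self,
    Multiset.card_cons]
  push_cast
  have : (m.count p : ℝ) + 1 ≠ 0 := by positivity
  by_cases h : (centralizerSize m : ℝ) = 0
  · simp [h]
  · field_simp
    ring

/-- The sum of `g` over the partitions of `n`, weighted by `partitionWeight θ`. -/
def partitionSum (θ : ℝ) (n : ℕ) (g : Multiset ℕ → ℝ) : ℝ :=
  ∑ l : n.Partition, partitionWeight θ l.parts * g l.parts

theorem sum_perm_eq_partitionSum (θ : ℝ) {α : Type*} [Fintype α] [DecidableEq α]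
    {n : ℕ} (hn : Fintype.card α = n) (g : Multiset ℕ → ℝ) :
    ∑ σ : Equiv.Perm α, θ ^ Multiset.card σ.partition.parts * g σ.partition.parts
      = n.factorial * partitionSum θ n g := by
  subst hn
  rw [← Finset.sum_fiberwise' Finset.univ Equiv.Perm.partition
    (fun l => θ ^ Multiset.card l.parts * g l.parts), partitionSum, Finset.mul_sum]
  refine Finset.sum_congr rfl fun l _ => ?_
  have h : (centralizerSize l.parts : ℝ) ≠ 0 := by
    exact_mod_cast (centralizerSize_pos fun _ => l.parts_pos).ne'
  rw [Finset.sum_const, nsmul_eq_mul, ← card_perm_partition_eq l, partitionWeight]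
  push_cast
  field_simp

theorem partitionSum_count_mul (θ : ℝ) {p : ℕ} (hp : 0 < p) (n : ℕ) (f : ℕ → ℝ) :
    partitionSum θ (n + p) (fun m => m.count p * f (m.count p))
      = θ / p * partitionSum θ n (fun m => f (m.count p + 1)) := by
  unfold partitionSum
  rw [Finset.mul_sum]
  symm
  refine Finset.sum_of_injOn (fun l : n.Partition => (⟨p ::ₘ l.parts, fun {i} hi => ?_, ?_⟩ : (n + p).Partition))
    ?_ (by simp) ?_ ?_
  · rcases Multiset.mem_cons.1 hi with rfl | hi
    exacts [hp, l.parts_pos hi]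
  · rw [Multiset.sum_cons, l.parts_sum, add_comm]
  · intro a _ b _ hab
    simpa [Nat.Partition.ext_iff] using hab
  · intro l _ hl
    have : p ∉ l.parts := fun hmem => hl <| by
      obtain ⟨t, ht⟩ := Multiset.exists_cons_of_mem hmem
      refine ⟨⟨t, fun {i} hi => l.parts_pos (ht ▸ Multiset.mem_cons_of_mem hi), ?_⟩, by simp, ?_⟩
      · have := l.parts_sum
        rw [ht, Multiset.sum_cons] at this
        omega
      · ext1
        exact ht.symm
    simp [Multiset.count_eq_zero_of_notMem this]
  · intro l _
    have := partitionWeight_cons θ hp l.parts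
    simp only [← mul_assoc, ← this, mul_comm (partitionWeight θ (p ::ₘ l.parts))]
    rw [Multiset.count_cons_self]
    ring

theorem partitionSum_count_mul_of_lt (θ : ℝ) {p n : ℕ} (h : n < p) (f : ℕ → ℝ) :
    partitionSum θ n (fun m => m.count p * f (m.count p)) = 0 := by
  refine Finset.sum_eq_zero fun l _ => ?_
  have : p ∉ l.parts := fun hp => (Nat.Partition.le_of_mem_parts hp).not_gt h
  simp [Multiset.count_eq_zero_of_notMem this]

theorem partitionSum_sum (θ : ℝ) (n : ℕ) {ι : Type*} (s : Finset ι) (g : ι → Multiset ℕ → ℝ) :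
    partitionSum θ n (fun m => ∑ i ∈ s, g i m) = ∑ i ∈ s, partitionSum θ n (g i) := by
  simp only [partitionSum, Finset.mul_sum]
  exact Finset.sum_comm

theorem partitionSum_const_mul (θ : ℝ) (n : ℕ) (c : ℝ) (g : Multiset ℕ → ℝ) :
    partitionSum θ n (fun m => c * g m) = c * partitionSum θ n g := by
  simp only [partitionSum, Finset.mul_sum]
  exact Finset.sum_congr rfl fun _ _ => by ring

theorem Nat.Partition.sum_mul_count {n : ℕ} (l : n.Partition) :
    ∑ p ∈ Finset.Icc 1 n, p * l.parts.count p = n := by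
  conv_rhs => rw [← l.parts_sum, Finset.sum_multiset_count]
  refine (Finset.sum_subset (fun i hi => ?_) fun i _ hi => ?_).symm.trans
    (Finset.sum_congr rfl fun i _ => by rw [smul_eq_mul, mul_comm])
  · rw [Multiset.mem_toFinset] at hi
    exact Finset.mem_Icc.2 ⟨l.parts_pos hi, Nat.Partition.le_of_mem_parts hi⟩
  · rw [Multiset.mem_toFinset] at hi
    simp [Multiset.count_eq_zero_of_notMem hi]

theorem mul_partitionSum_one (θ : ℝ) (n : ℕ) :
    n * partitionSum θ n (fun _ => 1) = θ * ∑ k ∈ Finset.range n, partitionSum θ k (fun _ => 1) := by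
  have h : n * partitionSum θ n (fun _ => 1)
      = ∑ p ∈ Finset.Icc 1 n, p * partitionSum θ n (fun m => m.count p * 1) := by
    simp only [← partitionSum_const_mul, ← partitionSum_sum]
    refine Finset.sum_congr rfl fun l _ => ?_
    congr 1
    have := l.sum_mul_count
    simp only [mul_one]
    exact_mod_cast this.symm
  rw [h, Finset.mul_sum]
  refine Finset.sum_bij' (fun p _ => n - p) (fun k _ => n - k) ?_ ?_ ?_ ?_ ?_
  · intro p hp; simp at hp ⊢; omega
  · intro p hp; simp at hp ⊢; omega
  · intro p hp; simp at hp ⊢; omega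
  · intro p hp; simp at hp ⊢; omega
  · intro p hp
    rw [Finset.mem_Icc] at hp
    obtain ⟨k, rfl⟩ := Nat.exists_eq_add_of_le' hp.2
    have hp0 : (p : ℝ) ≠ 0 := by exact_mod_cast (by omega : p ≠ 0)
    rw [partitionSum_count_mul θ hp.1 k (fun _ => 1), Nat.add_sub_cancel]
    field_simp

theorem factorial_mul_partitionSum_one (θ : ℝ) (n : ℕ) :
    n.factorial * partitionSum θ n (fun _ => 1) = ∏ k ∈ Finset.range n, (θ + k) := by
  induction n with
  | zero =>
    simp [partitionSum, partitionWeight, centralizerSize]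
  | succ n ih =>
    have h1 := mul_partitionSum_one θ (n + 1)
    rw [Finset.sum_range_succ, mul_add, ← mul_partitionSum_one θ n] at h1
    rw [Finset.prod_range_succ, ← ih, Nat.factorial_succ]
    push_cast at h1 ⊢
    linear_combination (n.factorial : ℝ) * h1

theorem mem_partitionsOf {ι : Type*} [DecidableEq ι] {S : Finset ι} {P : Finset (Finset ι)} :
    P ∈ partitionsOf S ↔ (∀ C ∈ P, C ⊆ S) ∧ (∀ C ∈ P, C.Nonempty) ∧
      ∀ j ∈ S, ∃! C, C ∈ P ∧ j ∈ C := by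
  simp [partitionsOf, Finset.subset_iff (s₁ := P)]

theorem insert_mem_partitionsOf {ι : Type*} [DecidableEq ι] {S B : Finset ι}
    {P : Finset (Finset ι)} (hB : B.Nonempty) (hBS : B ⊆ S) (hP : P ∈ partitionsOf (S \ B)) :
    B ∉ P ∧ insert B P ∈ partitionsOf S := by
  rw [mem_partitionsOf] at hP ⊢
  obtain ⟨h1, h2, h3⟩ := hP
  have hdis : ∀ C ∈ P, ∀ j ∈ C, j ∉ B := fun C hC j hj => (Finset.mem_sdiff.1 (h1 C hC hj)).2
  refine ⟨fun h => ?_, ?_, ?_, fun j hj => ?_⟩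
  · obtain ⟨j, hj⟩ := hB
    exact hdis B h j hj hj
  · rw [Finset.forall_mem_insert]
    exact ⟨hBS, fun C hC => (h1 C hC).trans Finset.sdiff_subset⟩
  · rw [Finset.forall_mem_insert]
    exact ⟨hB, h2⟩
  · by_cases hjB : j ∈ B
    · refine ⟨B, ⟨Finset.mem_insert_self _ _, hjB⟩, ?_⟩
      rintro C ⟨hC, hjC⟩
      rcases Finset.mem_insert.1 hC with rfl | hC
      · rfl
      · exact absurd hjB (hdis C hC j hjC)
    · obtain ⟨C, ⟨hC, hjC⟩, huniq⟩ := h3 j (Finset.mem_sdiff.2 ⟨hj, hjB⟩)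
      refine ⟨C, ⟨Finset.mem_insert_of_mem hC, hjC⟩, ?_⟩
      rintro D ⟨hD, hjD⟩
      rcases Finset.mem_insert.1 hD with rfl | hD
      · exact absurd hjD hjB
      · exact huniq D ⟨hD, hjD⟩

theorem erase_mem_partitionsOf {ι : Type*} [DecidableEq ι] {S B : Finset ι}
    {P : Finset (Finset ι)} (hP : P ∈ partitionsOf S) (hB : B ∈ P) :
    P.erase B ∈ partitionsOf (S \ B) := by
  rw [mem_partitionsOf] at hP ⊢
  obtain ⟨h1, h2, h3⟩ := hP
  refine ⟨fun C hC j hj => ?_, fun C hC => h2 C (Finset.mem_of_mem_erase hC), fun j hj => ?_⟩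
  · obtain ⟨hne, hC⟩ := Finset.mem_erase.1 hC
    exact Finset.mem_sdiff.2 ⟨h1 C hC hj, fun hjB =>
      hne ((h3 j (h1 C hC hj)).unique ⟨hC, hj⟩ ⟨hB, hjB⟩)⟩
  · obtain ⟨hjS, hjB⟩ := Finset.mem_sdiff.1 hj
    obtain ⟨C, ⟨hC, hjC⟩, huniq⟩ := h3 j hjS
    refine ⟨C, ⟨Finset.mem_erase.2 ⟨?_, hC⟩, hjC⟩,
      fun D hD => huniq D ⟨Finset.mem_of_mem_erase hD.1, hD.2⟩⟩
    rintro rfl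
    exact hjB hjC

theorem sum_partitionsOf_sum_block {ι M : Type*} [DecidableEq ι] [AddCommMonoid M]
    (S : Finset ι) (a : ι) (f : Finset (Finset ι) → Finset ι → M) :
    ∑ B ∈ (S.erase a).powerset.erase ∅, ∑ P ∈ partitionsOf (S \ B), f (insert B P) B
      = ∑ P ∈ partitionsOf S, ∑ B ∈ P.filter (a ∉ ·), f P B := by
  rw [Finset.sum_sigma', Finset.sum_sigma']
  have key : ∀ x : (Σ _ : Finset ι, Finset (Finset ι)),
      x ∈ ((S.erase a).powerset.erase ∅).sigma (fun B => partitionsOf (S \ B)) →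
        x.1.Nonempty ∧ x.1 ⊆ S ∧ a ∉ x.1 ∧ x.2 ∈ partitionsOf (S \ x.1) := fun x hx => by
    simp only [Finset.mem_sigma, Finset.mem_erase, Finset.mem_powerset, Finset.subset_erase] at hx
    exact ⟨Finset.nonempty_iff_ne_empty.2 hx.1.1, hx.1.2.1, hx.1.2.2, hx.2⟩
  refine Finset.sum_bij' (fun x _ => ⟨insert x.1 x.2, x.1⟩) (fun y _ => ⟨y.2, y.1.erase y.2⟩)
    ?_ ?_ ?_ ?_ ?_
  · intro x hx
    obtain ⟨h1, h2, h3, h4⟩ := key x hx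
    simp [(insert_mem_partitionsOf h1 h2 h4).2, h3]
  · rintro ⟨P, B⟩ hx
    simp only [Finset.mem_sigma, Finset.mem_filter] at hx
    obtain ⟨hP, hB, haB⟩ := hx
    have hP' := mem_partitionsOf.1 hP
    simp only [Finset.mem_sigma, Finset.mem_erase, Finset.mem_powerset, Finset.subset_erase]
    exact ⟨⟨(hP'.2.1 B hB).ne_empty, hP'.1 B hB, haB⟩, erase_mem_partitionsOf hP hB⟩
  · rintro ⟨B, P⟩ hx
    obtain ⟨h1, h2, h3, h4⟩ := key _ hx
    simp [Finset.erase_insert (insert_mem_partitionsOf h1 h2 h4).1]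
  · rintro ⟨P, B⟩ hx
    simp only [Finset.mem_sigma, Finset.mem_filter] at hx
    simp [Finset.insert_erase hx.2.1]
  · intro x hx
    rfl

theorem card_filter_notMem_of_mem_partitionsOf {ι : Type*} [DecidableEq ι] {S : Finset ι} {a : ι}
    (ha : a ∈ S) {P : Finset (Finset ι)} (hP : P ∈ partitionsOf S) :
    (P.filter (a ∉ ·)).card + 1 = P.card := by
  obtain ⟨C, ⟨hC, haC⟩, huniq⟩ := (mem_partitionsOf.1 hP).2.2 a ha
  have : P.filter (a ∉ ·) = P.erase C := by
    ext D
    simp only [Finset.mem_filter, Finset.mem_erase]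
    constructor
    · rintro ⟨hD, haD⟩
      exact ⟨fun h => haD (h ▸ haC), hD⟩
    · rintro ⟨hne, hD⟩
      exact ⟨hD, fun haD => hne (huniq D ⟨hD, haD⟩)⟩
  rw [this, Finset.card_erase_add_one hC]

theorem singleton_mem_partitionsOf {ι : Type*} [DecidableEq ι] {S : Finset ι} (hS : S.Nonempty) :
    {S} ∈ partitionsOf S := by
  rw [mem_partitionsOf]
  refine ⟨by simp, by simpa using hS, fun j hj => ⟨S, by simpa using hj, by simp⟩⟩

theorem eq_singleton_of_mem_partitionsOf {ι : Type*} [DecidableEq ι] {S : Finset ι}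
    {P : Finset (Finset ι)} (hP : P ∈ partitionsOf S) (h : P.card = 1) : P = {S} := by
  obtain ⟨C, rfl⟩ := Finset.card_eq_one.1 h
  obtain ⟨h1, -, h3⟩ := mem_partitionsOf.1 hP
  congr 1
  refine (h1 C (by simp)).antisymm fun j hj => ?_
  obtain ⟨D, ⟨hD, hjD⟩, -⟩ := h3 j hj
  rwa [Finset.mem_singleton.1 hD] at hjD

/-- The recursion expressing moments through cumulants, by splitting off the part of the set
partition away from `a`. -/
theorem cumulantOn_add_sum {ι 𝕜 : Type*} [DecidableEq ι] [Field 𝕜] {S : Finset ι} {a : ι}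
    (ha : a ∈ S) (M : Finset ι → 𝕜) :
    cumulantOn S M + ∑ B ∈ (S.erase a).powerset.erase ∅, cumulantOn (S \ B) M * M B = M S := by
  obtain ⟨c, hc⟩ : ∃ c : ℕ → 𝕜, ∀ r, c r = (-1 : 𝕜) ^ (r - 1) * ((r - 1).factorial : 𝕜) :=
    ⟨_, fun _ => rfl⟩
  have h : ∑ B ∈ (S.erase a).powerset.erase ∅, cumulantOn (S \ B) M * M B
      = ∑ P ∈ partitionsOf S, ((P.card - 1 : ℕ) : 𝕜) * c (P.card - 1) * ∏ C ∈ P, M C := by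
    have h1 : ∀ B ∈ (S.erase a).powerset.erase ∅, cumulantOn (S \ B) M * M B
        = ∑ P ∈ partitionsOf (S \ B),
          c ((insert B P).card - 1) * ∏ C ∈ insert B P, M C := fun B hB => by
      simp only [Finset.mem_erase, Finset.mem_powerset, Finset.subset_erase] at hB
      rw [cumulantOn, Finset.sum_mul]
      refine Finset.sum_congr rfl fun P hP => ?_
      have hBP := (insert_mem_partitionsOf (Finset.nonempty_iff_ne_empty.2 hB.1) hB.2.1 hP).1
      rw [Finset.card_insert_of_notMem hBP, Finset.prod_insert hBP, Nat.add_sub_cancel, hc]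
      ring
    rw [Finset.sum_congr rfl h1, sum_partitionsOf_sum_block S a
      (fun P _ => c (P.card - 1) * ∏ C ∈ P, M C)]
    refine Finset.sum_congr rfl fun P hP => ?_
    rw [Finset.sum_const, nsmul_eq_mul, ← card_filter_notMem_of_mem_partitionsOf ha hP,
      Nat.add_sub_cancel, ← mul_assoc]
  rw [h, cumulantOn, ← Finset.sum_add_distrib,
    Finset.sum_eq_single_of_mem {S} (singleton_mem_partitionsOf ⟨a, ha⟩)]
  · simp
  · intro P hP hne
    have h1 := card_filter_notMem_of_mem_partitionsOf ha hP
    have h2 : P.card ≠ 1 := fun h => hne (eq_singleton_of_mem_partitionsOf hP h)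
    obtain ⟨r, hr⟩ : ∃ r, P.card = r + 2 := ⟨P.card - 2, by omega⟩
    rw [hr, hc]
    simp only [Nat.add_sub_cancel, show r + 2 - 1 = r + 1 from rfl, Nat.factorial_succ]
    push_cast
    ring

/-- The moments of the Poisson law of parameter `r`, through the recursion
`m_{n+1} = r ∑ₖ (n choose k) m_k`. -/
def poissonMoment (r : ℝ) : ℕ → ℝ
  | 0 => 1
  | n + 1 => r * ∑ k : Fin (n + 1), (n.choose k) * poissonMoment r k

theorem poissonMoment_succ (r : ℝ) (n : ℕ) :
    poissonMoment r (n + 1) = r * ∑ k ∈ Finset.range (n + 1), n.choose k * poissonMoment r k := by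
  rw [poissonMoment, Finset.sum_range]

theorem cumulantOn_poissonMoment {ι : Type*} [DecidableEq ι] (r : ℝ) {S : Finset ι}
    (hS : S.Nonempty) : cumulantOn S (fun Δ => poissonMoment r Δ.card) = r := by
  induction S using Finset.strongInduction with
  | H S ih =>
    obtain ⟨a, ha⟩ := hS
    have h1 := cumulantOn_add_sum ha (fun Δ => poissonMoment r Δ.card)
    have h2 : ∑ B ∈ (S.erase a).powerset.erase ∅,
          cumulantOn (S \ B) (fun Δ => poissonMoment r Δ.card) * poissonMoment r B.card
        = ∑ B ∈ (S.erase a).powerset.erase ∅, r * poissonMoment r B.card := by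
      refine Finset.sum_congr rfl fun B hB => ?_
      simp only [Finset.mem_erase, Finset.mem_powerset, Finset.subset_erase] at hB
      rw [ih _ (Finset.sdiff_ssubset hB.2.1 (Finset.nonempty_iff_ne_empty.2 hB.1))
        ⟨a, Finset.mem_sdiff.2 ⟨ha, hB.2.2⟩⟩]
    have h3 := Finset.add_sum_erase (S.erase a).powerset
      (fun B => r * poissonMoment r B.card) (Finset.empty_mem_powerset _)
    rw [← Finset.mul_sum (S.erase a).powerset, Finset.sum_powerset_apply_card] at h3
    simp only [nsmul_eq_mul] at h3
    rw [← poissonMoment_succ, Finset.card_erase_add_one ha, Finset.card_empty, poissonMoment] at h3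
    linarith

theorem isBigO_mul_sub_mul {α : Type*} {l : Filter α} {f g e : α → ℝ} {a b : ℝ}
    (he : e =O[l] (fun _ => (1 : ℝ)))
    (hf : (fun x => f x - a) =O[l] e) (hg : (fun x => g x - b) =O[l] e) :
    (fun x => f x * g x - a * b) =O[l] e := by
  have hg1 : g =O[l] (fun _ => (1 : ℝ)) := by
    simpa using (hg.trans he).add (Asymptotics.isBigO_const_const b one_ne_zero l)
  have h1 : (fun x => (f x - a) * g x) =O[l] e := by simpa using hf.mul hg1
  refine (h1.add (hg.const_mul_left a)).congr_left fun x => ?_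
  ring

theorem isBigO_prod_sub_prod {α ι : Type*} {l : Filter α} {e : α → ℝ}
    (he : e =O[l] (fun _ => (1 : ℝ))) (s : Finset ι) {f : ι → α → ℝ} {a : ι → ℝ}
    (h : ∀ i ∈ s, (fun x => f i x - a i) =O[l] e) :
    (fun x => ∏ i ∈ s, f i x - ∏ i ∈ s, a i) =O[l] e := by
  induction s using Finset.cons_induction with
  | empty => simpa using Asymptotics.isBigO_zero e l
  | cons i s hi ih =>
    simp only [Finset.prod_cons]
    exact isBigO_mul_sub_mul he (h i (by simp)) (ih fun j hj => h j (by simp [hj]))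

theorem isBigO_cumulantOn_sub {α ι : Type*} [DecidableEq ι] {l : Filter α} {e : α → ℝ}
    (he : e =O[l] (fun _ => (1 : ℝ))) (S : Finset ι) {M : α → Finset ι → ℝ} {m : Finset ι → ℝ}
    (h : ∀ C, (fun x => M x C - m C) =O[l] e) :
    (fun x => cumulantOn S (M x) - cumulantOn S m) =O[l] e := by
  simp only [cumulantOn, ← Finset.sum_sub_distrib, ← mul_sub]
  exact Asymptotics.IsBigO.fun_sum fun P _ =>
    (isBigO_prod_sub_prod he P fun C _ => h C).const_mul_left _

theorem partitionSum_one_pos {θ : ℝ} (hθ : 0 < θ) (n : ℕ) :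
    0 < partitionSum θ n (fun _ => 1) := by
  have h : 0 < (n.factorial : ℝ) * partitionSum θ n (fun _ => 1) := by
    rw [factorial_mul_partitionSum_one]
    exact Finset.prod_pos fun k _ => by positivity
  exact pos_of_mul_pos_right h (by positivity)

theorem cycleCount_eq_card_parts {N : ℕ} (σ : Equiv.Perm (Fin N)) :
    cycleCount σ = Multiset.card σ.partition.parts := by
  rw [cycleCount, Equiv.Perm.parts_partition, Equiv.Perm.sum_cycleType, Multiset.card_add,
    Multiset.card_replicate, Fintype.card_fin]

theorem cyclesOfLength_eq_count_parts {N : ℕ} (p : ℕ) (σ : Equiv.Perm (Fin N)) :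
    cyclesOfLength p σ = σ.partition.parts.count p := by
  rw [cyclesOfLength, Equiv.Perm.parts_partition, Equiv.Perm.sum_cycleType, Multiset.count_add,
    Multiset.count_replicate, Fintype.card_fin]
  by_cases hp : p = 1
  · have : (1 : ℕ) ∉ σ.cycleType := fun h => by
      simpa using Equiv.Perm.one_lt_of_mem_cycleType h
    simp [hp, Multiset.count_eq_zero_of_notMem this]
  · simp [hp, Ne.symm hp]

theorem ewensE_cyclesOfLength (θ : ℝ) (p N : ℕ) (f : ℕ → ℝ) :
    ewensE θ N (fun σ => f (cyclesOfLength p σ))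
      = partitionSum θ N (fun m => f (m.count p)) / partitionSum θ N (fun _ => 1) := by
  have h := sum_perm_eq_partitionSum θ (Fintype.card_fin N) (fun m => f (m.count p))
  simp only [ewensE, cycleCount_eq_card_parts, cyclesOfLength_eq_count_parts]
  rw [← factorial_mul_partitionSum_one, h,
    mul_div_mul_left _ _ (Nat.cast_ne_zero.2 N.factorial_ne_zero)]

theorem ewensE_cyclesOfLength_pow_succ {θ : ℝ} (hθ : 0 < θ) {p : ℕ} (hp : 0 < p) (n j : ℕ) :
    ewensE θ (n + p) (fun σ => (cyclesOfLength p σ : ℝ) ^ (j + 1))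
      = θ / p * ((partitionSum θ n (fun _ => 1) / partitionSum θ (n + p) (fun _ => 1)) *
        ∑ i ∈ Finset.range (j + 1),
          j.choose i * ewensE θ n (fun σ => (cyclesOfLength p σ : ℝ) ^ i)) := by
  have hn := (partitionSum_one_pos hθ n).ne'
  have hnp := (partitionSum_one_pos hθ (n + p)).ne'
  have h1 := partitionSum_count_mul θ hp n (fun c => (c : ℝ) ^ j)
  have h2 : partitionSum θ n (fun m => ((m.count p + 1 : ℕ) : ℝ) ^ j)
      = ∑ i ∈ Finset.range (j + 1), j.choose i * partitionSum θ n (fun m => (m.count p : ℝ) ^ i) := by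
    simp only [← partitionSum_const_mul, ← partitionSum_sum]
    congr 1
    ext m
    push_cast
    rw [add_pow]
    exact Finset.sum_congr rfl fun i _ => by rw [one_pow, mul_one, mul_comm]
  rw [ewensE_cyclesOfLength θ p (n + p) (fun c => (c : ℝ) ^ (j + 1))]
  simp only [pow_succ', h1, h2, fun i => ewensE_cyclesOfLength θ p n (fun c => (c : ℝ) ^ i),
    ← mul_div_assoc, ← Finset.sum_div]
  field_simp

theorem isBigO_const_div_add (c : ℝ) {b : ℝ} (hb : 0 ≤ b) :
    (fun n : ℕ => c / (n + b)) =O[Filter.atTop] (fun n : ℕ => 1 / (n : ℝ)) := by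
  refine Asymptotics.IsBigO.of_bound |c| ?_
  filter_upwards [Filter.eventually_ge_atTop 1] with n hn
  have hn' : (0 : ℝ) < n := by exact_mod_cast hn
  rw [Real.norm_eq_abs, Real.norm_eq_abs, abs_div, abs_of_pos (by positivity : (0 : ℝ) < n + b),
    abs_of_pos (by positivity : (0 : ℝ) < 1 / n), mul_one_div]
  gcongr
  linarith

theorem isBigO_one_div_nat_one :
    (fun n : ℕ => 1 / (n : ℝ)) =O[Filter.atTop] (fun _ => (1 : ℝ)) :=
  tendsto_one_div_atTop_nhds_zero_nat.isBigO_one ℝ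

theorem isBigO_one_div_of_isBigO_shift (p : ℕ) {f : ℕ → ℝ}
    (h : (fun n => f (n + p)) =O[Filter.atTop] (fun n : ℕ => 1 / (n : ℝ))) :
    f =O[Filter.atTop] (fun n : ℕ => 1 / (n : ℝ)) := by
  rw [← Filter.map_add_atTop_eq_nat p, Asymptotics.isBigO_map]
  refine h.trans (Asymptotics.IsBigO.of_bound (1 + p) ?_)
  filter_upwards [Filter.eventually_ge_atTop 1] with n hn
  have hn' : (1 : ℝ) ≤ n := by exact_mod_cast hn
  simp only [Function.comp_apply, Nat.cast_add]
  rw [Real.norm_of_nonneg (by positivity), Real.norm_of_nonneg (by positivity), mul_one_div,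
    div_le_div_iff₀ (by positivity) (by positivity)]
  nlinarith [(Nat.cast_nonneg p : (0 : ℝ) ≤ p)]

theorem partitionSum_one_div_succ {θ : ℝ} (hθ : 0 < θ) (n : ℕ) :
    partitionSum θ n (fun _ => 1) / partitionSum θ (n + 1) (fun _ => 1) - 1
      = (1 - θ) / (n + θ) := by
  have h1 := factorial_mul_partitionSum_one θ (n + 1)
  rw [Finset.prod_range_succ, ← factorial_mul_partitionSum_one, Nat.factorial_succ] at h1
  push_cast at h1
  have hf : (n.factorial : ℝ) ≠ 0 := Nat.cast_ne_zero.2 n.factorial_ne_zero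
  have h2 : (n + 1) * partitionSum θ (n + 1) (fun _ => 1)
      = (θ + n) * partitionSum θ n (fun _ => 1) :=
    mul_left_cancel₀ hf (by linear_combination h1)
  have hnp := (partitionSum_one_pos hθ (n + 1)).ne'
  have : (n : ℝ) + θ ≠ 0 := by positivity
  field_simp
  linear_combination -h2

theorem isBigO_partitionSum_one_ratio {θ : ℝ} (hθ : 0 < θ) (p : ℕ) :
    (fun n => partitionSum θ n (fun _ => 1) / partitionSum θ (n + p) (fun _ => 1) - 1)
      =O[Filter.atTop] (fun n : ℕ => 1 / (n : ℝ)) := by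
  induction p with
  | zero =>
    refine (Asymptotics.isBigO_zero _ _).congr_left fun n => ?_
    rw [add_zero, div_self (partitionSum_one_pos hθ n).ne', sub_self]
  | succ p ih =>
    have h1 : (fun n => partitionSum θ (n + p) (fun _ => 1) /
        partitionSum θ (n + p + 1) (fun _ => 1) - 1)
        =O[Filter.atTop] (fun n : ℕ => 1 / (n : ℝ)) := by
      refine (isBigO_const_div_add (1 - θ) (b := p + θ) (by positivity)).congr_left fun n => ?_
      rw [partitionSum_one_div_succ hθ, Nat.cast_add, add_assoc]
    refine (isBigO_mul_sub_mul isBigO_one_div_nat_one ih h1).congr_left fun n => ?_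
    rw [div_mul_div_cancel₀ (partitionSum_one_pos hθ (n + p)).ne', mul_one, add_assoc]

theorem isBigO_ewensE_cyclesOfLength_pow {θ : ℝ} (hθ : 0 < θ) {p : ℕ} (hp : 0 < p) (j : ℕ) :
    (fun N => ewensE θ N (fun σ => (cyclesOfLength p σ : ℝ) ^ j) - poissonMoment (θ / p) j)
      =O[Filter.atTop] (fun n : ℕ => 1 / (n : ℝ)) := by
  induction j using Nat.strong_induction_on with
  | _ j ih =>
    rcases j with _ | j
    · refine (Asymptotics.isBigO_zero _ _).congr_left fun n => ?_
      have h := ewensE_cyclesOfLength θ p n (fun _ => 1)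
      rw [div_self (partitionSum_one_pos hθ n).ne'] at h
      simp only [pow_zero, h, poissonMoment, sub_self]
    · refine isBigO_one_div_of_isBigO_shift p ?_
      simp only [ewensE_cyclesOfLength_pow_succ hθ hp, poissonMoment_succ, ← mul_sub]
      refine Asymptotics.IsBigO.const_mul_left ?_ _
      have hsum : (fun n => ∑ i ∈ Finset.range (j + 1),
            j.choose i * ewensE θ n (fun σ => (cyclesOfLength p σ : ℝ) ^ i)
          - ∑ i ∈ Finset.range (j + 1), j.choose i * poissonMoment (θ / p) i)
          =O[Filter.atTop] (fun n : ℕ => 1 / (n : ℝ)) := by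
        simp only [← Finset.sum_sub_distrib, ← mul_sub]
        exact Asymptotics.IsBigO.fun_sum fun i hi =>
          (ih i (Finset.mem_range.1 hi)).const_mul_left _
      simpa using isBigO_mul_sub_mul isBigO_one_div_nat_one
        (isBigO_partitionSum_one_ratio hθ p) hsum

/-- Section 4: the `ℓ`-th cumulant of the number of cycles of length `p` of an Ewens(θ)
random permutation satisfies `κ_ℓ(Γ^{(N)}_p) = θ/p + O(N^{−1})`. -/
theorem cumulant_cycle_count (θ : ℝ) (hθ : 0 < θ) (p ℓ : ℕ) (hp : 0 < p) (hℓ : 0 < ℓ) :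
    ∃ C : ℝ, ∀ N : ℕ, 1 ≤ N →
      |cumulantOn (Finset.univ : Finset (Fin ℓ))
          (fun Δ => ewensE θ N (fun σ => (cyclesOfLength p σ : ℝ) ^ Δ.card))
        - θ / p| ≤ C / N := by
  have : NeZero ℓ := ⟨hℓ.ne'⟩
  obtain ⟨C, -, hC⟩ := Asymptotics.bound_of_isBigO_nat_atTop
    (isBigO_cumulantOn_sub isBigO_one_div_nat_one (Finset.univ : Finset (Fin ℓ))
      fun Δ => isBigO_ewensE_cyclesOfLength_pow hθ hp Δ.card)
  rw [cumulantOn_poissonMoment (θ / p) Finset.univ_nonempty] at hC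
  refine ⟨C, fun N hN => ?_⟩
  have hN' : (0 : ℝ) < N := by exact_mod_cast hN
  have h := hC (x := N) (by positivity)
  rwa [Real.norm_eq_abs, Real.norm_of_nonneg (by positivity), mul_one_div] at h

end
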